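/- arXiv:2604.23498 — 4 statements merged into one kernel-verified Lean document; each statement's English description precedes it below -/
import Mathlib

section
/- Exact preconditioner-isolating decomposition (Lemma 3.1). Let d ≥ 1, n ≥ 1, let H be an invertible d×d real matrix, let η₀ > 0 and α ∈ (1/2,1) with η_t = η₀ t^{−α}, and for 1 ≤ t ≤ n let P_t be invertible d×d real matrices. Suppose vectors Δ_t, ξ_t, u_t ∈ ℝ^d (1 ≤ t ≤ n, with Δ_{n+1} also given) satisfy the recursion Δ_{t+1} = (I − η_t P_t H) Δ_t − η_t P_t ξ_t − η_t P_t u_t for all 1 ≤ t ≤ n. Then, with A_t := η_t^{−1} (P_t H)^{−1}, the exact identity (1/n) Σ_{t=1}^n Δ_t = −(1/n) H^{−1} Σ_{t=1}^n ξ_t − (1/n) H^{−1} Σ_{t=1}^n u_t + R_n holds, where R_n := (1/n)[ A₁Δ₁ − A_nΔ_{n+1} + Σ_{t=2}^n (A_t − A_{t−1}) Δ_t ]. -/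
open Finset

/-- Matrix acting on a Euclidean-space vector. -/
noncomputable def mulV {d : ℕ} (M : Matrix (Fin d) (Fin d) ℝ)
    (v : EuclideanSpace ℝ (Fin d)) : EuclideanSpace ℝ (Fin d) :=
  Matrix.toEuclideanLin M v

/-- Step sizes `η_t = η₀ t^{−α}`. -/
noncomputable def eta (η₀ α : ℝ) (t : ℕ) : ℝ := η₀ * (t : ℝ) ^ (-α)

/-- The dynamic remainder
`R_n = (1/n)[ A₁Δ₁ − A_nΔ_{n+1} + Σ_{t=2}^n (A_t − A_{t−1}) Δ_t ]`. -/
noncomputable def Rrem {d : ℕ} (A : ℕ → Matrix (Fin d) (Fin d) ℝ)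
    (Δ : ℕ → EuclideanSpace ℝ (Fin d)) (n : ℕ) : EuclideanSpace ℝ (Fin d) :=
  (n : ℝ)⁻¹ • (mulV (A 1) (Δ 1) - mulV (A n) (Δ (n + 1))
    + ∑ t ∈ Finset.Icc 2 n, mulV (A t - A (t - 1)) (Δ t))

lemma mulV_sub {d : ℕ} (M : Matrix (Fin d) (Fin d) ℝ) (v w : EuclideanSpace ℝ (Fin d)) :
    mulV M (v - w) = mulV M v - mulV M w := map_sub _ _ _

lemma mulV_smul {d : ℕ} (M : Matrix (Fin d) (Fin d) ℝ) (c : ℝ) (v : EuclideanSpace ℝ (Fin d)) :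
    mulV M (c • v) = c • mulV M v := map_smul _ _ _

lemma mulV_sum {d : ℕ} {ι : Type*} (M : Matrix (Fin d) (Fin d) ℝ) (s : Finset ι)
    (v : ι → EuclideanSpace ℝ (Fin d)) :
    mulV M (∑ i ∈ s, v i) = ∑ i ∈ s, mulV M (v i) := map_sum _ _ _

lemma sub_mulV {d : ℕ} (M N : Matrix (Fin d) (Fin d) ℝ) (v : EuclideanSpace ℝ (Fin d)) :
    mulV (M - N) v = mulV M v - mulV N v := by
  simp [mulV]

lemma smul_mulV {d : ℕ} (c : ℝ) (M : Matrix (Fin d) (Fin d) ℝ) (v : EuclideanSpace ℝ (Fin d)) :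
    mulV (c • M) v = c • mulV M v := by
  simp [mulV]

lemma mulV_mulV {d : ℕ} (M N : Matrix (Fin d) (Fin d) ℝ) (v : EuclideanSpace ℝ (Fin d)) :
    mulV M (mulV N v) = mulV (M * N) v := by
  simp [mulV, Matrix.toLpLin_apply]

lemma one_mulV {d : ℕ} (v : EuclideanSpace ℝ (Fin d)) :
    mulV (1 : Matrix (Fin d) (Fin d) ℝ) v = v := by
  simp [mulV]

lemma eta_pos {η₀ : ℝ} (hη₀ : 0 < η₀) (α : ℝ) {t : ℕ} (ht : 1 ≤ t) : 0 < eta η₀ α t :=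
  mul_pos hη₀ (Real.rpow_pos_of_pos (by exact_mod_cast ht) _)

/-- Summation by parts for matrices acting on the increments of a sequence of vectors. -/
lemma sum_mulV_sub_mulV_succ {d : ℕ} (A : ℕ → Matrix (Fin d) (Fin d) ℝ)
    (Δ : ℕ → EuclideanSpace ℝ (Fin d)) {n : ℕ} (hn : 1 ≤ n) :
    ∑ t ∈ Finset.Icc 1 n, (mulV (A t) (Δ t) - mulV (A t) (Δ (t + 1)))
      = mulV (A 1) (Δ 1) - mulV (A n) (Δ (n + 1))
        + ∑ t ∈ Finset.Icc 2 n, mulV (A t - A (t - 1)) (Δ t) := by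
  induction n, hn using Nat.le_induction with
  | base => simp
  | succ k hk ih =>
    rw [Finset.sum_Icc_succ_top (by omega), Finset.sum_Icc_succ_top (by omega), ih, sub_mulV,
      Nat.add_sub_cancel]
    abel

/-- One step of the recursion, solved for the current error. -/
lemma eq_of_preconditioned_step {d : ℕ} {H P : Matrix (Fin d) (Fin d) ℝ} (hH : IsUnit H)
    (hP : IsUnit P) {η : ℝ} (hη : η ≠ 0) {x y ξ u : EuclideanSpace ℝ (Fin d)}
    (h : y = x - η • mulV (P * H) x - η • mulV P ξ - η • mulV P u) :
    x = mulV (η⁻¹ • (P * H)⁻¹) x - mulV (η⁻¹ • (P * H)⁻¹) y - mulV H⁻¹ ξ - mulV H⁻¹ u := by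
  have hPH : (P * H)⁻¹ * (P * H) = 1 :=
    Matrix.nonsing_inv_mul _ ((Matrix.isUnit_iff_isUnit_det _).1 (hP.mul hH))
  have hPH' : (P * H)⁻¹ * P = H⁻¹ := by
    rw [Matrix.mul_inv_rev, Matrix.mul_assoc,
      Matrix.nonsing_inv_mul _ ((Matrix.isUnit_iff_isUnit_det _).1 hP), Matrix.mul_one]
  have hy : mulV (η⁻¹ • (P * H)⁻¹) y
      = mulV (η⁻¹ • (P * H)⁻¹) x - x - mulV H⁻¹ ξ - mulV H⁻¹ u := by
    simp only [h, mulV_sub, mulV_smul, smul_mulV, mulV_mulV, Matrix.smul_mul, hPH, hPH', one_mulV,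
      smul_inv_smul₀ hη]
  rw [hy]
  abel

/-- **Exact preconditioner-isolating decomposition** (Lemma 3.1). -/
theorem stmt_0 (d n : ℕ) (hd : 1 ≤ d) (hn : 1 ≤ n)
    (H : Matrix (Fin d) (Fin d) ℝ) (hH : IsUnit H)
    (η₀ α : ℝ) (hη₀ : 0 < η₀) (hα : 1 / 2 < α ∧ α < 1)
    (P : ℕ → Matrix (Fin d) (Fin d) ℝ)
    (hP : ∀ t, 1 ≤ t → t ≤ n → IsUnit (P t))
    (Δ ξ u : ℕ → EuclideanSpace ℝ (Fin d))
    (hrec : ∀ t, 1 ≤ t → t ≤ n →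
      Δ (t + 1) = Δ t - eta η₀ α t • mulV (P t * H) (Δ t)
        - eta η₀ α t • mulV (P t) (ξ t) - eta η₀ α t • mulV (P t) (u t)) :
    (n : ℝ)⁻¹ • ∑ t ∈ Finset.Icc 1 n, Δ t
      = -((n : ℝ)⁻¹ • mulV H⁻¹ (∑ t ∈ Finset.Icc 1 n, ξ t))
        - (n : ℝ)⁻¹ • mulV H⁻¹ (∑ t ∈ Finset.Icc 1 n, u t)
        + Rrem (fun t => (eta η₀ α t)⁻¹ • (P t * H)⁻¹) Δ n := by
  have hsum : ∑ t ∈ Finset.Icc 1 n, Δ t = ∑ t ∈ Finset.Icc 1 n,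
      (mulV ((eta η₀ α t)⁻¹ • (P t * H)⁻¹) (Δ t) - mulV ((eta η₀ α t)⁻¹ • (P t * H)⁻¹) (Δ (t + 1))
        - mulV H⁻¹ (ξ t) - mulV H⁻¹ (u t)) := by
    refine Finset.sum_congr rfl fun t ht => ?_
    obtain ⟨h1, h2⟩ := Finset.mem_Icc.1 ht
    exact eq_of_preconditioned_step hH (hP t h1 h2) (eta_pos hη₀ α h1).ne' (hrec t h1 h2)
  rw [hsum, Finset.sum_sub_distrib, Finset.sum_sub_distrib,
    sum_mulV_sub_mulV_succ (fun t => (eta η₀ α t)⁻¹ • (P t * H)⁻¹) Δ hn, Rrem, ← mulV_sum,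
    ← mulV_sum, smul_sub, smul_sub]
  abel
end

section
/- Saturating construction for the sufficiency hypotheses (Proposition 3.1/thm:sharpness). Fix α ∈ (1/2,1), η₀ > 0, and 0 < β ≤ (α+1)/2. Then there exist deterministic real sequences (M_t)_{t≥1} ⊂ (0,∞) and (Δ_t)_{t≥1} ⊂ ℝ, explicitly M_t = m₀ + c_M Σ_{s=2}^t (−1)^s s^{−β} and Δ_t = c_Δ (−1)^t t^{−α/2} for suitable constants m₀, c_M, c_Δ > 0 with m₀ larger than c_M times the supremum of the alternating partial sums, such that: |M_t − M_{t−1}| = c_M t^{−β} for all t ≥ 2; there are constants 0 < m₋ ≤ m₊ with m₋ ≤ M_t ≤ m₊ for all t; |Δ_t| = c_Δ t^{−α/2}; and, with η_t = η₀ t^{−α}, A_t := η_t^{−1} M_t and R_n := (1/n)[ A₁Δ₁ − A_nΔ_{n+1} + Σ_{t=2}^n (A_t − A_{t−1}) Δ_t ], there exist constants 0 < c ≤ C and N₀ such that for all n ≥ N₀: c·n^{(α+1)/2−β} ≤ √n |R_n| ≤ C·n^{(α+1)/2−β} if 0 < β < (α+1)/2, and c ≤ √n |R_n| ≤ C if β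 = (α+1)/2. In particular √n R_n does not converge to 0. -/
open Finset Filter Topology

/-- Scalar dynamic remainder (dimension `d = 1`, `H = 1`):
`R_n = (1/n)[ A₁Δ₁ − A_nΔ_{n+1} + Σ_{t=2}^n (A_t − A_{t−1}) Δ_t ]`. -/
noncomputable def RremScalar (A Δ : ℕ → ℝ) (n : ℕ) : ℝ :=
  (n : ℝ)⁻¹ * (A 1 * Δ 1 - A n * Δ (n + 1)
    + ∑ t ∈ Finset.Icc 2 n, (A t - A (t - 1)) * Δ t)

/-- Partial sums of the alternating series `Σ_{s≥2} (−1)^s s^{−β}`. -/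
noncomputable def altSum (β : ℝ) (t : ℕ) : ℝ :=
  ∑ s ∈ Finset.Icc 2 t, (-1 : ℝ) ^ s * (s : ℝ) ^ (-β)

lemma altSum_succ (β : ℝ) {t : ℕ} (ht : 1 ≤ t) :
    altSum β (t + 1) = altSum β t + (-1 : ℝ) ^ (t + 1) * ((t + 1 : ℕ) : ℝ) ^ (-β) := by
  unfold altSum
  rw [Finset.sum_Icc_succ_top (by omega)]

lemma altSum_parity_bounds {β : ℝ} (hβ : 0 < β) {t : ℕ} (ht : 1 ≤ t) :
    (Even t → (t : ℝ) ^ (-β) ≤ altSum β t ∧ altSum β t ≤ 1) ∧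
      (Odd t → 0 ≤ altSum β t ∧ altSum β t + (t : ℝ) ^ (-β) ≤ 1) := by
  induction t, ht using Nat.le_induction with
  | base => simp [altSum]
  | succ t ht ih =>
    have htpos : (0 : ℝ) < t := by exact_mod_cast ht
    have hanti : ((t + 1 : ℕ) : ℝ) ^ (-β) ≤ (t : ℝ) ^ (-β) :=
      Real.rpow_le_rpow_of_nonpos htpos (by push_cast; linarith) (by linarith)
    rw [altSum_succ β ht]
    refine ⟨fun h => ?_, fun h => ?_⟩
    · have hodd : Odd t := by
        rcases Nat.even_or_odd t with h' | h'
        · exact absurd h (by simpa [Nat.even_add_one] using h')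
        · exact h'
      obtain ⟨h1, h2⟩ := ih.2 hodd
      rw [h.neg_one_pow]
      constructor <;> linarith
    · have heven : Even t := by
        rcases Nat.even_or_odd t with h' | h'
        · exact h'
        · exact absurd h (by simpa using h'.add_one)
      obtain ⟨h1, h2⟩ := ih.1 heven
      rw [h.neg_one_pow]
      constructor <;> linarith

lemma altSum_mem_Icc {β : ℝ} (hβ : 0 < β) {t : ℕ} (ht : 1 ≤ t) :
    0 ≤ altSum β t ∧ altSum β t ≤ 1 := by
  have hpos : (0 : ℝ) ≤ (t : ℝ) ^ (-β) := by positivity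
  obtain ⟨he, ho⟩ := altSum_parity_bounds hβ ht
  rcases Nat.even_or_odd t with h | h
  · exact ⟨hpos.trans (he h).1, (he h).2⟩
  · exact ⟨(ho h).1, by linarith [(ho h).2]⟩

lemma sum_Icc_two_natCast {n : ℕ} (hn : 1 ≤ n) :
    ∑ t ∈ Finset.Icc 2 n, (t : ℝ) = (n : ℝ) * (n + 1) / 2 - 1 := by
  induction n, hn using Nat.le_induction with
  | base => norm_num
  | succ n hn ih =>
    rw [Finset.sum_Icc_succ_top (by omega), ih]
    push_cast
    ring

lemma sum_rpow_neg_half_le {n : ℕ} (hn : 1 ≤ n) :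
    ∑ t ∈ Finset.Icc 2 n, (t : ℝ) ^ (-(1 / 2) : ℝ) ≤ 2 * √(n : ℝ) := by
  induction n, hn using Nat.le_induction with
  | base => norm_num
  | succ n hn ih =>
    rw [Finset.sum_Icc_succ_top (by omega), Real.rpow_neg (by positivity), ← Real.sqrt_eq_rpow]
    have hb : 0 < √((n + 1 : ℕ) : ℝ) := Real.sqrt_pos.2 (by positivity)
    have hb2 : √((n + 1 : ℕ) : ℝ) ^ 2 = n + 1 := by
      rw [Real.sq_sqrt (by positivity)]; push_cast; ring
    have ha2 : √(n : ℝ) ^ 2 = n := Real.sq_sqrt (by positivity)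
    have key : (√((n + 1 : ℕ) : ℝ))⁻¹ ≤ 2 * √((n + 1 : ℕ) : ℝ) - 2 * √(n : ℝ) := by
      rw [inv_le_iff_one_le_mul₀ hb]
      nlinarith [sq_nonneg (√((n + 1 : ℕ) : ℝ) - √(n : ℝ))]
    linarith

lemma sum_rpow_lower {γ : ℝ} (hγ : γ ≤ 1) {n : ℕ} (hn : 2 ≤ n) :
    (n : ℝ) ^ (γ + 1) / 2 ≤ ∑ t ∈ Finset.Icc 2 n, (t : ℝ) ^ γ := by
  have hn2 : (2 : ℝ) ≤ n := by exact_mod_cast hn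
  have hnpos : (0 : ℝ) < n := by linarith
  have hterm : ∀ t ∈ Finset.Icc 2 n, (n : ℝ) ^ (γ - 1) * t ≤ (t : ℝ) ^ γ := by
    intro t ht
    obtain ⟨h2, hle⟩ := Finset.mem_Icc.1 ht
    have htpos : (0 : ℝ) < t := by exact_mod_cast (by omega : 0 < t)
    calc (n : ℝ) ^ (γ - 1) * t ≤ (t : ℝ) ^ (γ - 1) * t := by
          gcongr ?_ * _
          exact Real.rpow_le_rpow_of_nonpos htpos (by exact_mod_cast hle) (by linarith)
      _ = (t : ℝ) ^ γ := by
          rw [← Real.rpow_add_one htpos.ne']; ring_nf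
  refine le_trans ?_ (Finset.sum_le_sum hterm)
  rw [← Finset.mul_sum, sum_Icc_two_natCast (by omega)]
  have hpow : (n : ℝ) ^ (γ + 1) = (n : ℝ) ^ (γ - 1) * (n : ℝ) ^ 2 := by
    rw [← Real.rpow_natCast, ← Real.rpow_add hnpos]; norm_num; ring_nf
  rw [hpow, mul_div_assoc]
  gcongr
  nlinarith

lemma sum_rpow_upper {γ : ℝ} (hγ : -(1 / 2) ≤ γ) {n : ℕ} (hn : 1 ≤ n) :
    ∑ t ∈ Finset.Icc 2 n, (t : ℝ) ^ γ ≤ 2 * (n : ℝ) ^ (γ + 1) := by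
  have hnpos : (0 : ℝ) < n := by exact_mod_cast hn
  have hterm : ∀ t ∈ Finset.Icc 2 n,
      (t : ℝ) ^ γ ≤ (n : ℝ) ^ (γ + 1 / 2) * (t : ℝ) ^ (-(1 / 2) : ℝ) := by
    intro t ht
    obtain ⟨h2, hle⟩ := Finset.mem_Icc.1 ht
    have htpos : (0 : ℝ) < t := by exact_mod_cast (by omega : 0 < t)
    calc (t : ℝ) ^ γ = (t : ℝ) ^ (γ + 1 / 2) * (t : ℝ) ^ (-(1 / 2) : ℝ) := by
          rw [← Real.rpow_add htpos]; ring_nf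
      _ ≤ _ := by
          gcongr
          linarith
  refine (Finset.sum_le_sum hterm).trans ?_
  rw [← Finset.mul_sum]
  calc (n : ℝ) ^ (γ + 1 / 2) * ∑ t ∈ Finset.Icc 2 n, (t : ℝ) ^ (-(1 / 2) : ℝ)
      ≤ (n : ℝ) ^ (γ + 1 / 2) * (2 * √(n : ℝ)) := by
        gcongr
        exact sum_rpow_neg_half_le hn
    _ = 2 * (n : ℝ) ^ (γ + 1) := by
        rw [Real.sqrt_eq_rpow, mul_left_comm, ← Real.rpow_add hnpos]; ring_nf

lemma inv_eta (η₀ α : ℝ) (t : ℕ) : (eta η₀ α t)⁻¹ = η₀⁻¹ * (t : ℝ) ^ α := by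
  rw [eta, mul_inv, Real.rpow_neg (by positivity), inv_inv]

lemma rpow_increment_mul_le {α : ℝ} (hα : 0 ≤ α) {t : ℕ} (ht : 1 ≤ t) :
    |(t : ℝ) ^ α - ((t - 1 : ℕ) : ℝ) ^ α| * (t : ℝ) ^ (-(α / 2)) ≤
      2 * ((t : ℝ) ^ (α / 2) - ((t - 1 : ℕ) : ℝ) ^ (α / 2)) := by
  have htpos : (0 : ℝ) < t := by exact_mod_cast ht
  have hsq : ∀ s : ℕ, (s : ℝ) ^ α = (s : ℝ) ^ (α / 2) * (s : ℝ) ^ (α / 2) := fun s => by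
    rw [← Real.rpow_add_of_nonneg (by positivity) (by positivity) (by positivity)]; ring_nf
  have hle : ((t - 1 : ℕ) : ℝ) ^ (α / 2) ≤ (t : ℝ) ^ (α / 2) := by
    gcongr
    exact Nat.sub_le t 1
  have hb : 0 ≤ ((t - 1 : ℕ) : ℝ) ^ (α / 2) := by positivity
  have ha : 0 < (t : ℝ) ^ (α / 2) := by positivity
  rw [hsq, hsq, Real.rpow_neg htpos.le, abs_of_nonneg (by nlinarith), ← div_eq_mul_inv,
    div_le_iff₀ ha]
  nlinarith

lemma sum_Icc_two_sub_pred (f : ℕ → ℝ) {n : ℕ} (hn : 1 ≤ n) :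
    ∑ t ∈ Finset.Icc 2 n, (f t - f (t - 1)) = f n - f 1 := by
  induction n, hn using Nat.le_induction with
  | base => simp
  | succ n hn ih =>
    rw [Finset.sum_Icc_succ_top (by omega), ih]
    simp

/-- The remainder equals a sum of positive powers up to an error of order `n^{α/2}`. -/
lemma abs_mul_RremScalar_sub_sum_le {α η₀ β B : ℝ} (hα : 0 ≤ α) (hη₀ : 0 < η₀) {M Δ : ℕ → ℝ}
    (hM : ∀ t, 1 ≤ t → |M t| ≤ B)
    (hMinc : ∀ t, 2 ≤ t → M t - M (t - 1) = (-1 : ℝ) ^ t * (t : ℝ) ^ (-β))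
    (hΔ : ∀ t, 1 ≤ t → Δ t = (-1 : ℝ) ^ t * (t : ℝ) ^ (-(α / 2))) {n : ℕ} (hn : 1 ≤ n) :
    |η₀ * n * RremScalar (fun t => (eta η₀ α t)⁻¹ * M t) Δ n
        - ∑ t ∈ Finset.Icc 2 n, (t : ℝ) ^ (α / 2 - β)| ≤ 4 * B * (n : ℝ) ^ (α / 2) := by
  have hB : 0 ≤ B := (abs_nonneg _).trans (hM 1 le_rfl)
  have hn1 : (1 : ℝ) ≤ n := by exact_mod_cast hn
  have hnpos : (0 : ℝ) < n := by linarith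
  have habsΔ : ∀ t, 1 ≤ t → |Δ t| = (t : ℝ) ^ (-(α / 2)) := fun t ht => by
    rw [hΔ t ht, abs_mul, abs_pow, abs_neg, abs_one, one_pow, one_mul,
      abs_of_nonneg (by positivity)]
  set E : ℕ → ℝ := fun t => ((t : ℝ) ^ α - ((t - 1 : ℕ) : ℝ) ^ α) * M (t - 1) * Δ t with hE
  have hterm : ∀ t ∈ Finset.Icc 2 n,
      ((eta η₀ α t)⁻¹ * M t - (eta η₀ α (t - 1))⁻¹ * M (t - 1)) * Δ t
        = η₀⁻¹ * ((t : ℝ) ^ (α / 2 - β) + E t) := by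
    intro t ht
    have h2 := (Finset.mem_Icc.1 ht).1
    have htpos : (0 : ℝ) < t := by exact_mod_cast (by omega : 0 < t)
    have hmain : (t : ℝ) ^ α * (M t - M (t - 1)) * Δ t = (t : ℝ) ^ (α / 2 - β) := by
      have hs : ((-1 : ℝ) ^ t) * (-1) ^ t = 1 := by
        rw [← mul_pow]; norm_num
      rw [hMinc t h2, hΔ t (by omega)]
      calc _ = ((-1 : ℝ) ^ t * (-1) ^ t) *
            ((t : ℝ) ^ α * (t : ℝ) ^ (-β) * (t : ℝ) ^ (-(α / 2))) := by ring
        _ = _ := by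
          rw [hs, one_mul, ← Real.rpow_add htpos, ← Real.rpow_add htpos]; ring_nf
    rw [inv_eta, inv_eta, ← hmain, hE]
    ring
  have hdecomp : η₀ * n * RremScalar (fun t => (eta η₀ α t)⁻¹ * M t) Δ n
        - ∑ t ∈ Finset.Icc 2 n, (t : ℝ) ^ (α / 2 - β)
      = M 1 * Δ 1 - (n : ℝ) ^ α * M n * Δ (n + 1) + ∑ t ∈ Finset.Icc 2 n, E t := by
    rw [RremScalar, Finset.sum_congr rfl hterm, ← Finset.mul_sum, Finset.sum_add_distrib,
      inv_eta, inv_eta, Nat.cast_one, Real.one_rpow]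
    field_simp
    ring
  have hfirst : |M 1 * Δ 1| ≤ B * (n : ℝ) ^ (α / 2) := by
    rw [abs_mul, habsΔ 1 le_rfl, Nat.cast_one, Real.one_rpow]
    gcongr
    · exact hM 1 le_rfl
    · exact Real.one_le_rpow hn1 (by linarith)
  have hlast : |(n : ℝ) ^ α * M n * Δ (n + 1)| ≤ B * (n : ℝ) ^ (α / 2) := by
    rw [abs_mul, abs_mul, habsΔ (n + 1) (by omega), abs_of_nonneg (by positivity)]
    calc (n : ℝ) ^ α * |M n| * ((n + 1 : ℕ) : ℝ) ^ (-(α / 2))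
        ≤ (n : ℝ) ^ α * B * (n : ℝ) ^ (-(α / 2)) := by
          refine mul_le_mul (by gcongr; exact hM n hn) ?_ (by positivity) (by positivity)
          exact Real.rpow_le_rpow_of_nonpos hnpos (by push_cast; linarith) (by linarith)
      _ = B * ((n : ℝ) ^ α * (n : ℝ) ^ (-(α / 2))) := by ring
      _ = B * (n : ℝ) ^ (α / 2) := by
          rw [← Real.rpow_add hnpos]; ring_nf
  have hsum : |∑ t ∈ Finset.Icc 2 n, E t| ≤ 2 * B * (n : ℝ) ^ (α / 2) := by
    have hEt : ∀ t ∈ Finset.Icc 2 n,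
        |E t| ≤ 2 * B * ((t : ℝ) ^ (α / 2) - ((t - 1 : ℕ) : ℝ) ^ (α / 2)) := by
      intro t ht
      have h2 := (Finset.mem_Icc.1 ht).1
      rw [hE]
      simp only
      rw [abs_mul, abs_mul, habsΔ t (by omega)]
      calc _ = |M (t - 1)| * (|(t : ℝ) ^ α - ((t - 1 : ℕ) : ℝ) ^ α| * (t : ℝ) ^ (-(α / 2))) := by
            ring
        _ ≤ B * (2 * ((t : ℝ) ^ (α / 2) - ((t - 1 : ℕ) : ℝ) ^ (α / 2))) :=
            mul_le_mul (hM _ (by omega)) (rpow_increment_mul_le hα (by omega))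
              (by positivity) hB
        _ = _ := by ring
    refine (Finset.abs_sum_le_sum_abs _ _).trans ((Finset.sum_le_sum hEt).trans ?_)
    rw [← Finset.mul_sum, sum_Icc_two_sub_pred (fun t => (t : ℝ) ^ (α / 2)) hn]
    gcongr
    simp
  rw [hdecomp]
  calc _ ≤ |M 1 * Δ 1| + |(n : ℝ) ^ α * M n * Δ (n + 1)| + |∑ t ∈ Finset.Icc 2 n, E t| :=
        (abs_add_le _ _).trans (by gcongr; exact abs_sub _ _)
    _ ≤ _ := by linarith

/-- Two-sided bound on the scaled remainder for an alternating construction. -/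
lemma sqrt_mul_abs_RremScalar_bounds {α η₀ β B : ℝ} (hα : 0 ≤ α) (hα2 : α ≤ 2) (hη₀ : 0 < η₀)
    (hβ : 0 ≤ β) (hβ1 : β < 1) (hβα : β ≤ (α + 1) / 2) {M Δ : ℕ → ℝ}
    (hM : ∀ t, 1 ≤ t → |M t| ≤ B)
    (hMinc : ∀ t, 2 ≤ t → M t - M (t - 1) = (-1 : ℝ) ^ t * (t : ℝ) ^ (-β))
    (hΔ : ∀ t, 1 ≤ t → Δ t = (-1 : ℝ) ^ t * (t : ℝ) ^ (-(α / 2))) :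
    ∃ N₀ : ℕ, ∀ n : ℕ, N₀ ≤ n →
      η₀⁻¹ / 4 * (n : ℝ) ^ ((α + 1) / 2 - β)
          ≤ √(n : ℝ) * |RremScalar (fun t => (eta η₀ α t)⁻¹ * M t) Δ n| ∧
        √(n : ℝ) * |RremScalar (fun t => (eta η₀ α t)⁻¹ * M t) Δ n|
          ≤ 3 * η₀⁻¹ * (n : ℝ) ^ ((α + 1) / 2 - β) := by
  have hlim : Tendsto (fun n : ℕ => 4 * B * (n : ℝ) ^ (-(1 - β))) atTop (𝓝 (4 * B * 0)) :=
    ((tendsto_rpow_neg_atTop (by linarith)).comp tendsto_natCast_atTop_atTop).const_mul _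
  rw [mul_zero] at hlim
  obtain ⟨N, hN⟩ := eventually_atTop.1
    (hlim.eventually_le_const (by norm_num : (0 : ℝ) < 1 / 4))
  refine ⟨max N 2, fun n hn => ?_⟩
  have hn2 : 2 ≤ n := (le_max_right _ _).trans hn
  have hnpos : (0 : ℝ) < n := by exact_mod_cast (by omega : 0 < n)
  set R := RremScalar (fun t => (eta η₀ α t)⁻¹ * M t) Δ n with hR
  set P := (n : ℝ) ^ (α / 2 - β + 1) with hP
  have hPpos : 0 < P := by positivity
  have herr : 4 * B * (n : ℝ) ^ (α / 2) ≤ P / 4 := by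
    have h := mul_le_mul_of_nonneg_right (hN n ((le_max_left _ _).trans hn)) hPpos.le
    have hpow : (n : ℝ) ^ (-(1 - β)) * P = (n : ℝ) ^ (α / 2) := by
      rw [hP, ← Real.rpow_add hnpos]; ring_nf
    rw [mul_assoc, hpow] at h
    linarith
  have hmain := (abs_mul_RremScalar_sub_sum_le hα hη₀ hM hMinc hΔ (by omega : 1 ≤ n)).trans herr
  rw [← hR] at hmain
  have hlo := sum_rpow_lower (γ := α / 2 - β) (by linarith) hn2
  have hup := sum_rpow_upper (γ := α / 2 - β) (by linarith) (by omega : 1 ≤ n)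
  rw [← hP] at hlo hup
  obtain ⟨h1, h2⟩ := abs_le.1 hmain
  have hscale : √(n : ℝ) * |R| = η₀⁻¹ * (√(n : ℝ))⁻¹ * |η₀ * n * R| := by
    have hs : 0 < √(n : ℝ) := Real.sqrt_pos.2 hnpos
    rw [abs_mul, abs_of_pos (by positivity : 0 < η₀ * (n : ℝ))]
    field_simp
    rw [Real.sq_sqrt hnpos.le, mul_comm]
  have hpow : (n : ℝ) ^ ((α + 1) / 2 - β) = (√(n : ℝ))⁻¹ * P := by
    rw [Real.sqrt_eq_rpow, ← Real.rpow_neg hnpos.le, hP, ← Real.rpow_add hnpos]; ring_nf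
  rw [hscale, hpow, abs_of_nonneg (by linarith)]
  constructor
  · calc η₀⁻¹ / 4 * ((√(n : ℝ))⁻¹ * P) = η₀⁻¹ * (√(n : ℝ))⁻¹ * (P / 4) := by ring
      _ ≤ _ := by gcongr; linarith
  · calc η₀⁻¹ * (√(n : ℝ))⁻¹ * (η₀ * n * R) ≤ η₀⁻¹ * (√(n : ℝ))⁻¹ * (3 * P) :=
          mul_le_mul_of_nonneg_left (by linarith) (by positivity)
      _ = _ := by ring

/-- **Saturating construction for the sufficiency hypotheses**
(Proposition thm:sharpness).  Since `n^{(α+1)/2−β} = 1` when `β = (α+1)/2`,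
the two displayed cases are stated uniformly as the two-sided bound
`c·n^{(α+1)/2−β} ≤ √n |R_n| ≤ C·n^{(α+1)/2−β}`. -/
theorem stmt_4 (α η₀ β : ℝ) (hα : 1 / 2 < α ∧ α < 1) (hη₀ : 0 < η₀)
    (hβ : 0 < β ∧ β ≤ (α + 1) / 2) :
    ∃ M Δ : ℕ → ℝ, ∃ m₀ cM cΔ mlo mhi : ℝ,
      0 < m₀ ∧ 0 < cM ∧ 0 < cΔ ∧
      -- m₀ dominates cM times the (bounded) alternating partial sums
      (∀ t : ℕ, 2 ≤ t →
        cM * |∑ s ∈ Finset.Icc 2 t, (-1 : ℝ) ^ s * (s : ℝ) ^ (-β)| < m₀) ∧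
      -- explicit formulas
      (∀ t : ℕ, 1 ≤ t →
        M t = m₀ + cM * ∑ s ∈ Finset.Icc 2 t, (-1 : ℝ) ^ s * (s : ℝ) ^ (-β)) ∧
      (∀ t : ℕ, 1 ≤ t → Δ t = cΔ * (-1 : ℝ) ^ t * (t : ℝ) ^ (-(α / 2))) ∧
      -- one-step increments and two-sided bounds
      (∀ t : ℕ, 2 ≤ t → |M t - M (t - 1)| = cM * (t : ℝ) ^ (-β)) ∧
      0 < mlo ∧ mlo ≤ mhi ∧
      (∀ t : ℕ, 1 ≤ t → mlo ≤ M t ∧ M t ≤ mhi) ∧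
      (∀ t : ℕ, 1 ≤ t → |Δ t| = cΔ * (t : ℝ) ^ (-(α / 2))) ∧
      -- the scaled remainder is of exact order n^{(α+1)/2−β}
      (∃ c C : ℝ, ∃ N₀ : ℕ, 0 < c ∧ c ≤ C ∧ ∀ n : ℕ, N₀ ≤ n →
        c * (n : ℝ) ^ ((α + 1) / 2 - β)
            ≤ Real.sqrt n * |RremScalar (fun t => (eta η₀ α t)⁻¹ * M t) Δ n|
        ∧ Real.sqrt n * |RremScalar (fun t => (eta η₀ α t)⁻¹ * M t) Δ n|
            ≤ C * (n : ℝ) ^ ((α + 1) / 2 - β)) ∧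
      -- in particular √n R_n does not converge to 0
      ¬ Tendsto (fun n : ℕ =>
          Real.sqrt n * RremScalar (fun t => (eta η₀ α t)⁻¹ * M t) Δ n)
        atTop (𝓝 0) := by
  obtain ⟨hα1, hα2⟩ := hα
  obtain ⟨hβ0, hβα⟩ := hβ
  have habs : ∀ t : ℕ, |(-1 : ℝ) ^ t| = 1 := fun t => by simp
  have hMinc : ∀ t : ℕ, 2 ≤ t → (2 + altSum β t) - (2 + altSum β (t - 1))
      = (-1 : ℝ) ^ t * (t : ℝ) ^ (-β) := by
    intro t ht
    obtain ⟨s, rfl⟩ : ∃ s, t = s + 1 := ⟨t - 1, by omega⟩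
    rw [altSum_succ β (by omega), Nat.add_sub_cancel]
    ring
  have hMabs : ∀ t : ℕ, 1 ≤ t → |2 + altSum β t| ≤ 3 := fun t ht => by
    obtain ⟨h0, h1⟩ := altSum_mem_Icc hβ0 ht
    rw [abs_of_nonneg (by linarith)]
    linarith
  obtain ⟨N, hN⟩ := sqrt_mul_abs_RremScalar_bounds (by linarith) (by linarith) hη₀ hβ0.le
    (by linarith) hβα hMabs hMinc
    (Δ := fun t => (-1 : ℝ) ^ t * (t : ℝ) ^ (-(α / 2))) (fun _ _ => rfl)
  have hη : 0 < η₀⁻¹ := inv_pos.2 hη₀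
  refine ⟨fun t => 2 + altSum β t, fun t => (-1 : ℝ) ^ t * (t : ℝ) ^ (-(α / 2)),
    2, 1, 1, 1, 3, by norm_num, by norm_num, by norm_num, ?_, ?_, ?_, ?_, by norm_num,
    by norm_num, ?_, ?_, ⟨η₀⁻¹ / 4, 3 * η₀⁻¹, N, by positivity, by linarith, hN⟩, ?_⟩
  · intro t ht
    obtain ⟨h0, h1⟩ := altSum_mem_Icc hβ0 (by omega : 1 ≤ t)
    change 1 * |altSum β t| < 2
    rw [abs_of_nonneg h0]
    linarith
  · intro t _
    rw [one_mul]
    rfl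
  · intro t _
    rw [one_mul]
  · intro t ht
    rw [hMinc t ht, abs_mul, habs, abs_of_nonneg (by positivity)]
  · intro t ht
    obtain ⟨h0, h1⟩ := altSum_mem_Icc hβ0 ht
    constructor <;> linarith
  · intro t _
    rw [abs_mul, habs, abs_of_nonneg (by positivity)]
  · intro h
    have h' := h.abs
    rw [abs_zero] at h'
    obtain ⟨K, hK⟩ := eventually_atTop.1 (h'.eventually_lt_const (by positivity : 0 < η₀⁻¹ / 4))
    have hlt := hK (max (max N K) 1) ((le_max_right _ _).trans (le_max_left _ _))
    have hle := (hN (max (max N K) 1) ((le_max_left _ _).trans (le_max_left _ _))).1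
    rw [abs_mul, abs_of_nonneg (Real.sqrt_nonneg _)] at hlt
    have hone : (1 : ℝ) ≤ ((max (max N K) 1 : ℕ) : ℝ) ^ ((α + 1) / 2 - β) :=
      Real.one_le_rpow (by exact_mod_cast le_max_right _ _) (by linarith)
    nlinarith
end

section
/- Deterministic rate lemma for perturbed contraction recursions (key step in the proof of Proposition 2.1). Let α ∈ (1/2,1) and c, b > 0, let T₀ ≥ 1 be such that c t^{−α} ≤ 1 for all t ≥ T₀, and let (a_t)_{t≥1} be a sequence of nonnegative real numbers satisfying a_{t+1} ≤ (1 − c t^{−α}) a_t + b t^{−2α} for all t ≥ T₀. Then there exists a constant K > 0 such that a_t ≤ K t^{−α} for all t ≥ 1. -/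
open Filter Topology in
/-- Since `α < 1`, the harmonic term `t⁻¹` is eventually dominated by any multiple of `t ^ (-α)`. -/
lemma eventually_inv_le_mul_rpow_neg {α ε : ℝ} (hα : α < 1) (hε : 0 < ε) :
    ∀ᶠ t : ℕ in atTop, (t : ℝ)⁻¹ ≤ ε * (t : ℝ) ^ (-α) := by
  have h : Tendsto (fun t : ℕ => (t : ℝ) ^ (-(1 - α))) atTop (𝓝 0) :=
    (tendsto_rpow_neg_atTop (sub_pos.2 hα)).comp tendsto_natCast_atTop_atTop
  filter_upwards [h.eventually (ge_mem_nhds hε), eventually_ge_atTop 1] with t ht ht1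
  have hpos : (0 : ℝ) < t := by exact_mod_cast ht1
  calc (t : ℝ)⁻¹ = (t : ℝ) ^ (-(1 - α)) * (t : ℝ) ^ (-α) := by
        rw [← Real.rpow_add hpos, ← Real.rpow_neg_one]
        congr 1
        ring
    _ ≤ ε * (t : ℝ) ^ (-α) := by gcongr

/-- For `α ≤ 1`, one step multiplies `x ^ (-α)` by a factor at least `1 - x⁻¹`. -/
lemma one_sub_inv_mul_rpow_neg_le {α x : ℝ} (h1 : α ≤ 1) (hx : 0 < x) :
    (1 - x⁻¹) * x ^ (-α) ≤ (x + 1) ^ (-α) := by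
  have hfac : x + 1 = (1 + x⁻¹) * x := by field_simp
  have hinv : 0 < x⁻¹ := inv_pos.2 hx
  rw [hfac, Real.mul_rpow (by positivity) hx.le]
  gcongr
  calc 1 - x⁻¹ ≤ (1 + x⁻¹)⁻¹ := by
        rw [inv_eq_one_div (1 + x⁻¹), le_div_iff₀ (by positivity)]
        nlinarith
    _ = (1 + x⁻¹) ^ (-1 : ℝ) := (Real.rpow_neg_one _).symm
    _ ≤ (1 + x⁻¹) ^ (-α) := Real.rpow_le_rpow_of_exponent_le (by linarith) (by linarith)

/-- **Deterministic rate lemma for perturbed contraction recursions**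
(key step in the proof of Proposition 2.1). -/
theorem stmt_6 (α c b : ℝ) (T₀ : ℕ) (a : ℕ → ℝ)
    (hα : 1 / 2 < α ∧ α < 1) (hc : 0 < c) (hb : 0 < b) (hT₀ : 1 ≤ T₀)
    (hsmall : ∀ t : ℕ, T₀ ≤ t → c * (t : ℝ) ^ (-α) ≤ 1)
    (hnn : ∀ t : ℕ, 0 ≤ a t)
    (hrec : ∀ t : ℕ, T₀ ≤ t →
      a (t + 1) ≤ (1 - c * (t : ℝ) ^ (-α)) * a t + b * (t : ℝ) ^ (-(2 * α))) :
    ∃ K > 0, ∀ t : ℕ, 1 ≤ t → a t ≤ K * (t : ℝ) ^ (-α) := by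
  obtain ⟨T₁, hT₁⟩ := Filter.eventually_atTop.1
    (eventually_inv_le_mul_rpow_neg hα.2 (half_pos hc))
  set T := max T₀ T₁
  set S := ∑ i ∈ Finset.range (T + 1), a i * (i : ℝ) ^ α
  have hterm : ∀ i : ℕ, 0 ≤ a i * (i : ℝ) ^ α := fun i => mul_nonneg (hnn i) (by positivity)
  have hS : 0 ≤ S := Finset.sum_nonneg fun i _ => hterm i
  have hbc : 0 < 2 * b / c := by positivity
  set K := 2 * b / c + S with hK
  have hKb : b ≤ c / 2 * K := by
    have : c / 2 * (2 * b / c) = b := by field_simp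
    rw [hK, mul_add, this]
    have : 0 ≤ c / 2 * S := by positivity
    linarith
  have hKpos : 0 < K := by positivity
  have hinit : ∀ t : ℕ, 1 ≤ t → t ≤ T → a t ≤ K * (t : ℝ) ^ (-α) := by
    intro t ht htT
    have hpos : (0 : ℝ) < t := by exact_mod_cast ht
    have hle : a t * (t : ℝ) ^ α ≤ S :=
      Finset.single_le_sum (f := fun i : ℕ => a i * (i : ℝ) ^ α) (fun i _ => hterm i)
        (Finset.mem_range.2 (by omega))
    rw [Real.rpow_neg hpos.le, ← div_eq_mul_inv, le_div_iff₀ (by positivity)]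
    linarith
  refine ⟨K, hKpos, fun t ht => ?_⟩
  rcases le_total t T with htT | htT
  · exact hinit t ht htT
  clear ht
  induction t, htT using Nat.le_induction with
  | base => exact hinit T (hT₀.trans (le_max_left _ _)) le_rfl
  | succ t htT ih =>
    have ht0 : T₀ ≤ t := (le_max_left _ _).trans htT
    have hpos : (0 : ℝ) < t := by exact_mod_cast hT₀.trans ht0
    have hinv := hT₁ t ((le_max_right _ _).trans htT)
    have hstep := one_sub_inv_mul_rpow_neg_le hα.2.le hpos
    have hsq : (t : ℝ) ^ (-(2 * α)) = (t : ℝ) ^ (-α) * (t : ℝ) ^ (-α) := by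
      rw [← Real.rpow_add hpos]
      congr 1
      ring
    have hr := hrec t ht0
    have hs1 := hsmall t ht0
    rw [hsq] at hr
    have hs : 0 < (t : ℝ) ^ (-α) := by positivity
    push_cast
    set s := (t : ℝ) ^ (-α)
    calc a (t + 1) ≤ (1 - c * s) * a t + b * (s * s) := hr
      _ ≤ (1 - c * s) * (K * s) + (c / 2 * K) * (s * s) := by
        have : 0 ≤ 1 - c * s := by linarith
        gcongr
      _ = K * ((1 - c / 2 * s) * s) := by ring
      _ ≤ K * ((1 - (t : ℝ)⁻¹) * s) := by gcongr
      _ ≤ K * ((t : ℝ) + 1) ^ (-α) := by gcongr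
end

section
/- Almost-sure convergence of the SA matrix recursion to a deterministic conditional-mean target (final clause of Theorem 4.1). On a filtered probability space, let 0 < c ≤ 1 and ε > 0, let Q₀ ⪰ ε I be a deterministic symmetric d×d matrix, and let W_t (t ≥ 1) be symmetric-matrix-valued random variables such that W_t is F_t-measurable, W_t ⪰ ε I almost surely, sup_t E‖W_t‖_op² < ∞, and E[W_t | F_{t−1}] = W̄ almost surely for all t ≥ 1, where W̄ is a fixed symmetric positive definite matrix. Define Q_t = (1 − c/t) Q_{t−1} + (c/t) W_t. Then Q_t → W̄ almost surely as t → ∞. -/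
open MeasureTheory Filter Topology

/-- Operator norm of a matrix with respect to the Euclidean norm. -/
noncomputable def opNorm {d : ℕ} (M : Matrix (Fin d) (Fin d) ℝ) : ℝ :=
  ‖LinearMap.toContinuousLinearMap (Matrix.toEuclideanLin M)‖

/-- Each entry of a matrix is bounded by the operator norm. -/
theorem abs_apply_le_opNorm {d : ℕ} (M : Matrix (Fin d) (Fin d) ℝ) (i j : Fin d) :
    |M i j| ≤ opNorm M := by
  have h := (LinearMap.toContinuousLinearMap (Matrix.toEuclideanLin M)).le_opNorm
    (EuclideanSpace.single j (1 : ℝ))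
  have h2 := PiLp.norm_apply_le
    (Matrix.toEuclideanLin M (EuclideanSpace.single j (1 : ℝ))) i
  have h3 : Matrix.toEuclideanLin M (EuclideanSpace.single j (1 : ℝ)) i = M i j := by
    simp [Matrix.toLpLin_apply]
  rw [h3, Real.norm_eq_abs] at h2
  refine h2.trans ?_
  simpa [opNorm] using h

/-- A recursive weighted average with non-summable weights in `[0, 1]` forgets its initial value
and follows an input that tends to zero. -/
theorem tendsto_zero_of_averaging_recursion {a e z : ℕ → ℝ} (ha0 : ∀ n, 0 ≤ a n)
    (ha1 : ∀ n, a n ≤ 1) (hsum : Tendsto (fun n => ∑ i ∈ Finset.range n, a i) atTop atTop)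
    (he : Tendsto e atTop (𝓝 0)) (hz : ∀ n, z (n + 1) = (1 - a n) * z n + a n * e n) :
    Tendsto z atTop (𝓝 0) := by
  rw [Metric.tendsto_atTop]
  intro δ hδ
  obtain ⟨N, hN⟩ := Metric.tendsto_atTop.1 he (δ / 2) (half_pos hδ)
  have hbound : ∀ n, N ≤ n → |z n| - δ / 2 ≤
      |z N| * Real.exp (∑ i ∈ Finset.range N, a i - ∑ i ∈ Finset.range n, a i) := by
    intro n hn
    induction n, hn using Nat.le_induction with
    | base => simp; linarith
    | succ n hn ih =>
      have hen : |e n| ≤ δ / 2 := by simpa using (hN n hn).le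
      have habs : |z (n + 1)| ≤ (1 - a n) * |z n| + a n * |e n| := by
        rw [hz]
        refine (abs_add_le _ _).trans_eq ?_
        rw [abs_mul, abs_mul, abs_of_nonneg (ha0 n), abs_of_nonneg (sub_nonneg.2 (ha1 n))]
      have hstep : |z (n + 1)| - δ / 2 ≤ (1 - a n) * (|z n| - δ / 2) := by
        nlinarith [mul_le_mul_of_nonneg_left hen (ha0 n)]
      refine hstep.trans ((mul_le_mul_of_nonneg_left ih (sub_nonneg.2 (ha1 n))).trans ?_)
      have hexp : Real.exp (∑ i ∈ Finset.range N, a i - ∑ i ∈ Finset.range (n + 1), a i) =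
          Real.exp (-a n) *
            Real.exp (∑ i ∈ Finset.range N, a i - ∑ i ∈ Finset.range n, a i) := by
        rw [← Real.exp_add, Finset.sum_range_succ]
        ring_nf
      rw [hexp, mul_left_comm]
      gcongr
      exact Real.one_sub_le_exp_neg _
  have hlim : Tendsto (fun n => |z N| *
      Real.exp (∑ i ∈ Finset.range N, a i - ∑ i ∈ Finset.range n, a i)) atTop (𝓝 0) := by
    have h : Tendsto (fun n => ∑ i ∈ Finset.range N, a i - ∑ i ∈ Finset.range n, a i)
        atTop atBot := by
      simpa only [sub_eq_add_neg, Function.comp_def] using tendsto_atBot_add_const_left atTop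
        (∑ i ∈ Finset.range N, a i) (tendsto_neg_atTop_atBot.comp hsum)
    simpa using (Real.tendsto_exp_atBot.comp h).const_mul |z N|
  obtain ⟨N', hN'⟩ := eventually_atTop.1 (hlim.eventually_lt_const (half_pos hδ))
  refine ⟨max N N', fun n hn => ?_⟩
  have h1 := hbound n (le_of_max_le_left hn)
  have h2 := hN' n (le_of_max_le_right hn)
  rw [Real.dist_eq, sub_zero]
  linarith

/-- If the running sums of the weighted noise converge, a stochastic approximation recursion
driven by this noise tends to zero. -/
theorem tendsto_zero_of_tendsto_sum_noise {a ξ x : ℕ → ℝ} {l : ℝ} (ha0 : ∀ n, 0 ≤ a n)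
    (ha1 : ∀ n, a n ≤ 1) (hsum : Tendsto (fun n => ∑ i ∈ Finset.range n, a i) atTop atTop)
    (hl : Tendsto (fun n => ∑ i ∈ Finset.range n, a i * ξ i) atTop (𝓝 l))
    (hx : ∀ n, x (n + 1) = (1 - a n) * x n + a n * ξ n) :
    Tendsto x atTop (𝓝 0) := by
  have hgap : Tendsto (fun n => l - ∑ i ∈ Finset.range n, a i * ξ i) atTop (𝓝 0) := by
    simpa using hl.const_sub l
  have h := tendsto_zero_of_averaging_recursion
    (z := fun n => x n + (l - ∑ i ∈ Finset.range n, a i * ξ i)) ha0 ha1 hsum hgap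
    (fun n => by rw [hx, Finset.sum_range_succ]; ring)
  simpa using h.sub hgap

section MartingaleDifference

variable {Ω : Type*} {m0 : MeasurableSpace Ω} {μ : Measure Ω} [IsProbabilityMeasure μ]
  {F : Filtration ℕ m0} {ξ : ℕ → Ω → ℝ}

/-- Partial sums of square-integrable martingale differences have orthogonal increments. -/
theorem integral_sum_sq_of_condExp_eq_zero
    (hmeas : ∀ n, Measurable[F (n + 1)] (ξ n)) (hL2 : ∀ n, MemLp (ξ n) 2 μ)
    (hcond : ∀ n, μ[ξ n | F n] =ᵐ[μ] 0) (n : ℕ) :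
    ∫ ω, (∑ i ∈ Finset.range n, ξ i ω) ^ 2 ∂μ = ∑ i ∈ Finset.range n, ∫ ω, ξ i ω ^ 2 ∂μ := by
  induction n with
  | zero => simp
  | succ n ih =>
    set S : Ω → ℝ := fun ω => ∑ i ∈ Finset.range n, ξ i ω with hS
    have hSL2 : MemLp S 2 μ := memLp_finsetSum _ fun i _ => hL2 i
    have hSmeas : Measurable[F n] S := Finset.measurable_fun_sum _ fun i hi =>
      (hmeas i).mono (F.mono (Finset.mem_range.1 hi)) le_rfl
    have hint : Integrable (S * ξ n) μ := hSL2.integrable_mul (hL2 n)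
    have hcross : ∫ ω, (S * ξ n) ω ∂μ = 0 := by
      rw [← integral_condExp (F.le n)]
      refine integral_eq_zero_of_ae ?_
      filter_upwards [condExp_mul_of_stronglyMeasurable_left hSmeas.stronglyMeasurable hint
        ((hL2 n).integrable one_le_two), hcond n] with ω h1 h2
      simp [h1, h2]
    have hexpand : (fun ω => (∑ i ∈ Finset.range (n + 1), ξ i ω) ^ 2) =
        fun ω => S ω ^ 2 + 2 * (S * ξ n) ω + ξ n ω ^ 2 := by
      funext ω
      simp only [Finset.sum_range_succ, hS, Pi.mul_apply]
      ring
    have hadd : Integrable (fun ω => S ω ^ 2 + 2 * (S * ξ n) ω) μ :=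
      hSL2.integrable_sq.add (hint.const_mul 2)
    rw [hexpand, integral_add hadd (hL2 n).integrable_sq,
      integral_add hSL2.integrable_sq (hint.const_mul 2), integral_const_mul, hcross, ih,
      Finset.sum_range_succ]
    ring

/-- A series of martingale differences with summable variances converges almost surely. -/
theorem ae_exists_tendsto_sum_of_condExp_eq_zero
    (hmeas : ∀ n, Measurable[F (n + 1)] (ξ n)) (hL2 : ∀ n, MemLp (ξ n) 2 μ)
    (hcond : ∀ n, μ[ξ n | F n] =ᵐ[μ] 0) (hsum : Summable fun n => ∫ ω, ξ n ω ^ 2 ∂μ) :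
    ∀ᵐ ω ∂μ, ∃ l, Tendsto (fun n => ∑ i ∈ Finset.range n, ξ i ω) atTop (𝓝 l) := by
  have hSL2 : ∀ n, MemLp (fun ω => ∑ i ∈ Finset.range n, ξ i ω) 2 μ := fun n =>
    memLp_finsetSum _ fun i _ => hL2 i
  have hmart : Martingale (fun n ω => ∑ i ∈ Finset.range n, ξ i ω) F μ := by
    refine martingale_of_condExp_sub_eq_zero_nat (fun n => ?_)
      (fun n => (hSL2 n).integrable one_le_two) (fun n => ?_)
    · exact (Finset.measurable_fun_sum _ fun i hi =>
        (hmeas i).mono (F.mono (Finset.mem_range.1 hi)) le_rfl).stronglyMeasurable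
    · convert hcond n using 2
      funext ω
      simp [Finset.sum_range_succ]
  refine hmart.submartingale.exists_ae_tendsto_of_bdd
    (R := (∑' n, ∫ ω, ξ n ω ^ 2 ∂μ + 1).toNNReal) fun n => ?_
  rw [eLpNorm_one_eq_lintegral_enorm,
    ← ofReal_integral_norm_eq_lintegral_enorm ((hSL2 n).integrable one_le_two)]
  refine ENNReal.ofReal_le_ofReal ?_
  calc ∫ ω, ‖∑ i ∈ Finset.range n, ξ i ω‖ ∂μ
      ≤ ∫ ω, ((∑ i ∈ Finset.range n, ξ i ω) ^ 2 + 1) ∂μ := by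
        refine integral_mono ((hSL2 n).integrable one_le_two).norm
          ((hSL2 n).integrable_sq.add (integrable_const 1)) fun ω => ?_
        simp only [Real.norm_eq_abs]
        rw [← sq_abs]
        nlinarith [sq_nonneg (|∑ i ∈ Finset.range n, ξ i ω| - 1),
          abs_nonneg (∑ i ∈ Finset.range n, ξ i ω)]
    _ = ∑ i ∈ Finset.range n, ∫ ω, ξ i ω ^ 2 ∂μ + 1 := by
        rw [integral_add (hSL2 n).integrable_sq (integrable_const 1),
          integral_sum_sq_of_condExp_eq_zero hmeas hL2 hcond]
        simp
    _ ≤ ∑' n, ∫ ω, ξ n ω ^ 2 ∂μ + 1 := by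
        gcongr
        exact hsum.sum_le_tsum _ fun i _ => integral_nonneg fun ω => sq_nonneg _

/-- Almost sure convergence of a real-valued stochastic approximation recursion with step sizes
`c / (n + 1)` to the constant conditional mean of its input. -/
theorem ae_tendsto_of_stochastic_approximation {w q : ℕ → Ω → ℝ} {c m K : ℝ}
    (hc : 0 < c) (hc1 : c ≤ 1) (hmeas : ∀ n, Measurable[F (n + 1)] (w n))
    (hL2 : ∀ n, MemLp (w n) 2 μ) (hK : ∀ n, ∫ ω, w n ω ^ 2 ∂μ ≤ K)
    (hcond : ∀ n, μ[w n | F n] =ᵐ[μ] fun _ => m)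
    (hq : ∀ n ω, q (n + 1) ω = (1 - c / (n + 1)) * q n ω + c / (n + 1) * w n ω) :
    ∀ᵐ ω ∂μ, Tendsto (fun n => q n ω) atTop (𝓝 m) := by
  have hpos : ∀ n : ℕ, (0 : ℝ) < n + 1 := fun n => n.cast_add_one_pos
  have hξL2 : ∀ n, MemLp (fun ω => w n ω - m) 2 μ := fun n => (hL2 n).sub (memLp_const m)
  have hξcond : ∀ n : ℕ, μ[fun ω => c / (n + 1) * (w n ω - m) | F n] =ᵐ[μ] 0 := by
    intro n
    have h1 : μ[fun ω => c / (n + 1) * (w n ω - m) | F n] =ᵐ[μ]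
        (c / (n + 1) : ℝ) • μ[w n - fun _ => m | F n] :=
      condExp_smul (c / (n + 1) : ℝ) (w n - fun _ => m) (F n)
    have h2 : μ[w n - fun _ => m | F n] =ᵐ[μ] μ[w n | F n] - μ[fun _ => m | F n] :=
      condExp_sub ((hL2 n).integrable one_le_two) (integrable_const m) _
    filter_upwards [h1, h2, hcond n] with ω h1 h2 h3
    simp [h1, h2, h3, condExp_const (F.le n)]
  have hξK : ∀ n, ∫ ω, (w n ω - m) ^ 2 ∂μ ≤ 2 * K + 2 * m ^ 2 := by
    intro n
    calc ∫ ω, (w n ω - m) ^ 2 ∂μ ≤ ∫ ω, (2 * w n ω ^ 2 + 2 * m ^ 2) ∂μ := by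
          refine integral_mono (hξL2 n).integrable_sq
            (((hL2 n).integrable_sq.const_mul 2).add (integrable_const _)) fun ω => ?_
          change (w n ω - m) ^ 2 ≤ 2 * w n ω ^ 2 + 2 * m ^ 2
          nlinarith [sq_nonneg (w n ω + m)]
      _ = 2 * ∫ ω, w n ω ^ 2 ∂μ + 2 * m ^ 2 := by
          rw [integral_add ((hL2 n).integrable_sq.const_mul 2) (integrable_const _),
            integral_const_mul]
          simp
      _ ≤ 2 * K + 2 * m ^ 2 := by linarith [hK n]
  have hsummable : Summable fun n : ℕ => ∫ ω, (c / (n + 1) * (w n ω - m)) ^ 2 ∂μ := by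
    have hbase : Summable fun n : ℕ => c ^ 2 * (2 * K + 2 * m ^ 2) * (1 / ((n : ℝ) + 1) ^ 2) := by
      refine Summable.mul_left _ ?_
      simpa using (summable_nat_add_iff 1).2 (Real.summable_one_div_nat_pow.2 one_lt_two)
    refine hbase.of_nonneg_of_le (fun n => integral_nonneg fun ω => sq_nonneg _) fun n => ?_
    simp only [mul_pow]
    rw [integral_const_mul]
    refine (mul_le_mul_of_nonneg_left (hξK n) (sq_nonneg _)).trans_eq ?_
    rw [div_pow]
    ring
  have hdiv : Tendsto (fun n : ℕ => ∑ i ∈ Finset.range n, c / ((i : ℝ) + 1)) atTop atTop := by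
    have h := Real.tendsto_sum_range_one_div_nat_succ_atTop.const_mul_atTop hc
    simpa only [Finset.mul_sum, mul_one_div] using h
  filter_upwards [ae_exists_tendsto_sum_of_condExp_eq_zero
    (fun n => ((hmeas n).sub_const m).const_mul (c / ((n : ℝ) + 1)))
    (fun n => (hξL2 n).const_mul (c / ((n : ℝ) + 1))) hξcond hsummable] with ω ⟨l, hl⟩
  have h := tendsto_zero_of_tendsto_sum_noise (x := fun n => q n ω - m)
    (fun n => (div_pos hc (hpos n)).le)
    (fun n => (div_le_one (hpos n)).2 (by linarith [n.cast_nonneg (α := ℝ)])) hdiv hl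
    (fun n => by rw [hq]; ring)
  simpa using h.add_const m

end MartingaleDifference

/-- **Almost-sure convergence of the SA matrix recursion to a deterministic
conditional-mean target** (final clause of Theorem 4.1).  The Loewner order
`A ⪰ B` is expressed as `(A − B).PosSemidef`; the conditional expectation and
the measurability hypotheses are taken entrywise. -/
theorem stmt_11 {Ω : Type*} {m0 : MeasurableSpace Ω} (μ : Measure Ω)
    [IsProbabilityMeasure μ] (F : Filtration ℕ m0) (d : ℕ) (hd : 1 ≤ d)
    (c ε : ℝ) (hc : 0 < c) (hc1 : c ≤ 1) (hε : 0 < ε)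
    (Q₀ : Matrix (Fin d) (Fin d) ℝ)
    (hQ₀ : (Q₀ - ε • (1 : Matrix (Fin d) (Fin d) ℝ)).PosSemidef)
    (W : ℕ → Ω → Matrix (Fin d) (Fin d) ℝ)
    (hWmeas : ∀ t : ℕ, 1 ≤ t → ∀ i j : Fin d, Measurable[F t] fun ω => W t ω i j)
    (hWpsd : ∀ t : ℕ, 1 ≤ t → ∀ᵐ ω ∂μ,
      (W t ω - ε • (1 : Matrix (Fin d) (Fin d) ℝ)).PosSemidef)
    (hW2 : ∃ K : ℝ, ∀ t : ℕ, 1 ≤ t →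
      ∫⁻ ω, ENNReal.ofReal (opNorm (W t ω) ^ 2) ∂μ ≤ ENNReal.ofReal K)
    (Wbar : Matrix (Fin d) (Fin d) ℝ) (hWbar : Wbar.PosDef)
    (hcond : ∀ t : ℕ, 1 ≤ t → ∀ i j : Fin d,
      (μ[fun ω => W t ω i j | F (t - 1)]) =ᵐ[μ] fun _ => Wbar i j)
    (Q : ℕ → Ω → Matrix (Fin d) (Fin d) ℝ)
    (hQ0 : ∀ ω, Q 0 ω = Q₀)
    (hQrec : ∀ t : ℕ, 1 ≤ t → ∀ ω,
      Q t ω = (1 - c / t) • Q (t - 1) ω + (c / t) • W t ω) :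
    ∀ᵐ ω ∂μ, ∀ i j : Fin d,
      Tendsto (fun t : ℕ => Q t ω i j) atTop (𝓝 (Wbar i j)) := by
  obtain ⟨K, hK⟩ := hW2
  refine ae_all_iff.2 fun i => ae_all_iff.2 fun j => ?_
  have hmeas : ∀ n, Measurable[F (n + 1)] fun ω => W (n + 1) ω i j := fun n =>
    hWmeas (n + 1) n.succ_pos i j
  have hmeas0 : ∀ n, Measurable fun ω => W (n + 1) ω i j := fun n =>
    (hmeas n).mono (F.le _) le_rfl
  have hlin : ∀ n, ∫⁻ ω, ENNReal.ofReal (W (n + 1) ω i j ^ 2) ∂μ ≤ ENNReal.ofReal K := fun n =>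
    (lintegral_mono fun ω => ENNReal.ofReal_le_ofReal
      (sq_le_sq.2 ((abs_apply_le_opNorm _ i j).trans (le_abs_self _)))).trans
      (hK (n + 1) n.succ_pos)
  have hsq : ∀ n, Integrable (fun ω => W (n + 1) ω i j ^ 2) μ := fun n =>
    (lintegral_ofReal_ne_top_iff_integrable ((hmeas0 n).pow_const 2).aestronglyMeasurable
      (ae_of_all _ fun ω => sq_nonneg _)).1 ((hlin n).trans_lt ENNReal.ofReal_lt_top).ne
  refine ae_tendsto_of_stochastic_approximation (w := fun n ω => W (n + 1) ω i j)
    (K := max K 0) hc hc1 hmeas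
    (fun n => (memLp_two_iff_integrable_sq (hmeas0 n).aestronglyMeasurable).2 (hsq n))
    (fun n => ?_) (fun n => hcond (n + 1) n.succ_pos i j) (fun n ω => ?_)
  · rw [← ENNReal.ofReal_le_ofReal_iff (le_max_right _ _),
      ofReal_integral_eq_lintegral_ofReal (hsq n) (ae_of_all _ fun ω => sq_nonneg _)]
    exact (hlin n).trans (ENNReal.ofReal_le_ofReal (le_max_left _ _))
  · simp [hQrec (n + 1) n.succ_pos ω]
end
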